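/- The derivative formula ∂/∂θ [(1−θ)^b · Ψ_{pq}[a,b,c,d;a',b' | e; c',d'; σ,θ,ρ]] = −(bd/e) (1−θ)^{b−1} · Ψ_{pq}[a, b+1, c, d+1; a',b' | e+1; c',d'; σ, θ, ρ] holds for real θ with |θ| < 1 and fixed σ, ρ with |σ| < 1. -/

import Mathlib

open Complex

/-- Pochhammer symbol `(a)_n = a(a+1)⋯(a+n-1)` for complex `a`. -/
noncomputable def poch (a : ℂ) (n : ℕ) : ℂ := (ascPochhammer ℂ n).eval a

/-- `c` is not a nonpositive integer `0, -1, -2, …`. -/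
def notNonposInt (c : ℂ) : Prop := ∀ n : ℕ, c ≠ -(n : ℂ)

/-- Confluent hypergeometric series `Ξ₂(a,b;c;σ,ρ)`. -/
noncomputable def Xi2 (a b c σ ρ : ℂ) : ℂ :=
  ∑' mk : ℕ × ℕ, poch a mk.1 * poch b mk.1 /
    ((mk.1.factorial : ℂ) * (mk.2.factorial : ℂ) * poch c (mk.1 + mk.2)) * σ ^ mk.1 * ρ ^ mk.2

/-- Series `Ξ₁₀[a,b;a' | c; c'; σ,ρ]`. -/
noncomputable def Xi10 (a b a' c c' σ ρ : ℂ) : ℂ :=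
  ∑' mk : ℕ × ℕ, poch a mk.1 * poch b mk.1 * poch a' mk.2 /
    ((mk.1.factorial : ℂ) * (mk.2.factorial : ℂ) * poch c (mk.1 + mk.2) * poch c' mk.2) *
    σ ^ mk.1 * ρ ^ mk.2

/-- Triple hypergeometric series `Φ[a,b,c,d;e;σ,ω,ρ]`. -/
noncomputable def Phi3 (a b c d e σ ω ρ : ℂ) : ℂ :=
  ∑' t : ℕ × ℕ × ℕ, poch a t.1 * poch b t.2.1 * poch c t.1 * poch d t.2.1 /
    ((t.1.factorial : ℂ) * (t.2.1.factorial : ℂ) * (t.2.2.factorial : ℂ) *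
      poch e (t.1 + t.2.1 + t.2.2)) *
    σ ^ t.1 * ω ^ t.2.1 * ρ ^ t.2.2

/-- Gauss hypergeometric series `F(a,b;c;θ)`. -/
noncomputable def GaussF (a b c θ : ℂ) : ℂ :=
  ∑' n : ℕ, poch a n * poch b n / ((n.factorial : ℂ) * poch c n) * θ ^ n

/-- Series `Ξ_{pq}[a,b;a',b' | c; c',d'; σ,ρ]`, `p, q ∈ {0,1}`. -/
noncomputable def XiPQ (p q : ℕ) (a b a' b' c c' d' σ ρ : ℂ) : ℂ :=
  ∑' mk : ℕ × ℕ, poch a mk.1 * poch b mk.1 * poch a' (p * mk.2) * poch b' (q * (mk.1 + mk.2)) /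
    ((mk.1.factorial : ℂ) * (mk.2.factorial : ℂ) * poch c (mk.1 + mk.2) *
      poch c' (p * mk.2) * poch d' (q * (mk.1 + mk.2))) *
    σ ^ mk.1 * ρ ^ mk.2

/-- Series `Ψ_{pq}[a,b,c,d;a',b' | e; c',d'; σ,θ,ρ]`, `p, q ∈ {0,1}`. -/
noncomputable def PsiPQ (p q : ℕ) (a b c d a' b' e c' d' σ θ ρ : ℂ) : ℂ :=
  ∑' mk : ℕ × ℕ, poch a mk.1 * poch c mk.1 * poch a' (p * mk.2) * poch b' (q * (mk.1 + mk.2)) /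
    ((mk.1.factorial : ℂ) * (mk.2.factorial : ℂ) * poch e (mk.1 + mk.2) *
      poch c' (p * mk.2) * poch d' (q * (mk.1 + mk.2))) *
    GaussF b (e - d + (mk.1 : ℂ) + (mk.2 : ℂ)) (e + (mk.1 : ℂ) + (mk.2 : ℂ)) θ *
    σ ^ mk.1 * ρ ^ mk.2

theorem poch_zero (a : ℂ) : poch a 0 = 1 := by simp [poch]

theorem poch_succ (a : ℂ) (n : ℕ) : poch a (n + 1) = poch a n * (a + n) :=
  ascPochhammer_succ_eval n a

theorem poch_succ_left (a : ℂ) (n : ℕ) : poch a (n + 1) = a * poch (a + 1) n := by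
  induction n with
  | zero => simp [poch_succ, poch_zero]
  | succ n ih =>
    rw [poch_succ, ih, poch_succ (a + 1)]
    push_cast
    ring

theorem poch_one (n : ℕ) : poch 1 n = (n.factorial : ℂ) := by
  induction n with
  | zero => simp [poch_zero]
  | succ n ih =>
    rw [poch_succ, ih, Nat.factorial_succ]
    push_cast
    ring

theorem notNonposInt_one : notNonposInt 1 := fun n h => by
  have : ((1 + n : ℕ) : ℂ) = 0 := by
    push_cast
    rw [h]
    ring
  norm_cast at this
  omega

theorem notNonposInt.add_natCast_ne_zero {e : ℂ} (he : notNonposInt e) (n : ℕ) :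
    e + n ≠ 0 := fun h => he n (eq_neg_of_add_eq_zero_left h)

theorem notNonposInt.ne_zero {e : ℂ} (he : notNonposInt e) : e ≠ 0 := by
  simpa using he.add_natCast_ne_zero 0

theorem notNonposInt.add_natCast {e : ℂ} (he : notNonposInt e) (n : ℕ) :
    notNonposInt (e + n) := fun m h => by
  refine he.add_natCast_ne_zero (n + m) ?_
  push_cast
  linear_combination h

theorem notNonposInt.poch_ne_zero {e : ℂ} (he : notNonposInt e) (n : ℕ) : poch e n ≠ 0 := by
  induction n with
  | zero => simp [poch_zero]
  | succ n ih =>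
    rw [poch_succ]
    exact mul_ne_zero ih (he.add_natCast_ne_zero n)

theorem notNonposInt.exists_natCast_succ_le {e : ℂ} (he : notNonposInt e) :
    ∃ C : ℝ, 0 ≤ C ∧ ∀ l : ℕ, (l : ℝ) + 1 ≤ C * ‖e + l‖ := by
  have h1 : Filter.Tendsto (fun l : ℕ => (1 + (e - 1) * (1 / ((l : ℂ) + 1)))⁻¹) Filter.atTop
      (nhds 1) := by
    have := (((tendsto_one_div_add_atTop_nhds_zero_nat (𝕜 := ℂ)).const_mul (e - 1)).const_add
      1).inv₀ (by simp)
    simpa using this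
  obtain ⟨C, hC⟩ := (Metric.isBounded_range_of_tendsto _ h1).exists_norm_le
  refine ⟨C, (norm_nonneg _).trans (hC _ ⟨0, rfl⟩), fun l => ?_⟩
  have hl : (l : ℂ) + 1 ≠ 0 := Nat.cast_add_one_ne_zero l
  have hel := he.add_natCast_ne_zero l
  have h2 : (1 + (e - 1) * (1 / ((l : ℂ) + 1)))⁻¹ = ((l : ℂ) + 1) / (e + l) := by
    have h3 : 1 + (e - 1) * (1 / ((l : ℂ) + 1)) = (e + l) / ((l : ℂ) + 1) := by
      field_simp
      ring
    rw [h3, inv_div]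
  have h3 := hC _ ⟨l, rfl⟩
  simp only [h2, norm_div] at h3
  rw [div_le_iff₀ (norm_pos_iff.mpr hel)] at h3
  have h4 : ‖(l : ℂ) + 1‖ = (l : ℝ) + 1 := by
    exact_mod_cast Complex.norm_natCast (l + 1)
  rwa [h4] at h3

/-- Ratios of Pochhammer symbols grow polynomially, uniformly under integer shifts. -/
theorem exists_norm_poch_le (a : ℂ) {e : ℂ} (he : notNonposInt e) :
    ∃ N : ℕ, ∀ n k : ℕ, ‖poch (a + n) k‖ ≤ ((k : ℝ) + 1) ^ N * ‖poch (e + n) k‖ := by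
  obtain ⟨C, hC0, hC⟩ := he.exists_natCast_succ_le
  obtain ⟨N, hN⟩ := exists_nat_ge (‖a - e‖ * C)
  refine ⟨N, fun n k => ?_⟩
  induction k with
  | zero => simp [poch_zero]
  | succ k ih =>
    have hk : (0 : ℝ) < (k : ℝ) + 1 := by positivity
    have hfac : ‖a + n + k‖ ≤ (((k : ℝ) + 2) / (k + 1)) ^ N * ‖e + n + k‖ := by
      have h1 : ‖a + n + k‖ ≤ ‖e + n + k‖ + ‖a - e‖ := by
        have := norm_add_le (e + n + k) (a - e)
        rwa [show e + n + k + (a - e) = a + n + k by ring] at this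
      have h2 : (k : ℝ) + 1 ≤ C * ‖e + n + k‖ := by
        have := hC (n + k)
        push_cast at this
        rw [← add_assoc] at this
        linarith [(Nat.cast_nonneg n : (0 : ℝ) ≤ n)]
      have h3 : ‖a - e‖ ≤ N * (1 / ((k : ℝ) + 1)) * ‖e + n + k‖ := by
        rw [mul_one_div, div_mul_eq_mul_div, le_div_iff₀ hk]
        calc ‖a - e‖ * (k + 1) ≤ ‖a - e‖ * (C * ‖e + n + k‖) := by gcongr
          _ = ‖a - e‖ * C * ‖e + n + k‖ := by ring
          _ ≤ N * ‖e + n + k‖ := by gcongr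
      have h4 : 1 + (N : ℝ) * (1 / ((k : ℝ) + 1)) ≤ (((k : ℝ) + 2) / (k + 1)) ^ N := by
        have := one_add_mul_le_pow (a := 1 / ((k : ℝ) + 1))
          (by linarith [(by positivity : (0 : ℝ) ≤ 1 / ((k : ℝ) + 1))]) N
        rwa [show 1 + 1 / ((k : ℝ) + 1) = ((k : ℝ) + 2) / (k + 1) by field_simp; ring] at this
      calc ‖a + n + k‖ ≤ (1 + N * (1 / ((k : ℝ) + 1))) * ‖e + n + k‖ := by linarith
        _ ≤ _ := by gcongr
    rw [poch_succ, poch_succ, norm_mul, norm_mul]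
    calc ‖poch (a + n) k‖ * ‖a + n + k‖
        ≤ (((k : ℝ) + 1) ^ N * ‖poch (e + n) k‖) *
          ((((k : ℝ) + 2) / (k + 1)) ^ N * ‖e + n + k‖) := by gcongr
      _ = ((((k + 1 : ℕ) : ℝ)) + 1) ^ N * (‖poch (e + n) k‖ * ‖e + n + k‖) := by
        rw [div_pow]
        push_cast
        field_simp
        ring

theorem exists_norm_poch_le_factorial (a : ℂ) :
    ∃ N : ℕ, ∀ k : ℕ, ‖poch a k‖ ≤ ((k : ℝ) + 1) ^ N * (k.factorial : ℝ) := by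
  obtain ⟨N, hN⟩ := exists_norm_poch_le a notNonposInt_one
  refine ⟨N, fun k => ?_⟩
  simpa [poch_one] using hN 0 k

theorem exists_norm_poch_div_le (a : ℂ) {e : ℂ} (he : notNonposInt e) :
    ∃ N : ℕ, ∀ n k : ℕ, ‖poch (a + n) k / poch (e + n) k‖ ≤ ((k : ℝ) + 1) ^ N := by
  obtain ⟨N, hN⟩ := exists_norm_poch_le a he
  refine ⟨N, fun n k => ?_⟩
  rw [norm_div, div_le_iff₀ (norm_pos_iff.mpr ((he.add_natCast n).poch_ne_zero k))]
  exact hN n k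

theorem summable_succ_pow_mul_geometric {r : ℝ} (h0 : 0 ≤ r) (h1 : r < 1) (N : ℕ) :
    Summable fun n : ℕ => ((n : ℝ) + 1) ^ N * r ^ n := by
  obtain rfl | hr := h0.eq_or_lt
  · exact summable_of_ne_finset_zero (s := {0}) fun n hn => by
      simp [zero_pow (by simpa using hn : n ≠ 0)]
  · have h := summable_pow_mul_geometric_of_norm_lt_one N
      (by rwa [Real.norm_of_nonneg h0] : ‖r‖ < 1)
    have h2 := ((summable_nat_add_iff 1).mpr h).mul_right r⁻¹
    refine h2.congr fun n => ?_
    rw [pow_succ, ← mul_assoc, mul_inv_cancel_right₀ hr.ne']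
    push_cast
    rfl

theorem summable_succ_pow_mul_pow_div_factorial (R : ℝ) (h0 : 0 ≤ R) (N : ℕ) :
    Summable fun n : ℕ => ((n : ℝ) + 1) ^ N * (R ^ n / n.factorial) := by
  have h := summable_succ_pow_mul_geometric (r := 1 / 2) (by norm_num) (by norm_num) N
  have h2 := (Real.summable_pow_div_factorial (2 * R)).mul_left
    (∑' n : ℕ, ((n : ℝ) + 1) ^ N * (1 / 2) ^ n)
  refine h2.of_nonneg_of_le (fun n => by positivity) fun n => ?_
  have h3 := h.le_tsum n fun j _ => by positivity
  calc ((n : ℝ) + 1) ^ N * (R ^ n / n.factorial)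
      = (((n : ℝ) + 1) ^ N * (1 / 2) ^ n) * ((2 * R) ^ n / n.factorial) := by
        rw [mul_pow, one_div, inv_pow]
        field_simp
    _ ≤ _ := by gcongr

theorem exists_norm_gaussCoeff_le (b β : ℂ) {γ : ℂ} (hγ : notNonposInt γ) :
    ∃ N : ℕ, ∀ n j : ℕ, ‖poch b j * poch (β + n) j / ((j.factorial : ℂ) * poch (γ + n) j)‖ ≤
      ((j : ℝ) + 1) ^ N := by
  obtain ⟨N₁, h₁⟩ := exists_norm_poch_div_le b notNonposInt_one
  obtain ⟨N₂, h₂⟩ := exists_norm_poch_div_le β hγ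
  refine ⟨N₁ + N₂, fun n j => ?_⟩
  have := h₁ 0 j
  simp only [Nat.cast_zero, add_zero, poch_one] at this
  rw [mul_div_mul_comm, norm_mul, pow_add]
  exact mul_le_mul this (h₂ n j) (norm_nonneg _) (by positivity)

theorem exists_norm_GaussF_le (b β : ℂ) {γ : ℂ} (hγ : notNonposInt γ) {r : ℝ} (hr : r < 1) :
    ∃ K : ℝ, ∀ (n : ℕ) (z : ℂ), ‖z‖ < r → ‖GaussF b (β + n) (γ + n) z‖ ≤ K := by
  obtain ⟨N, hN⟩ := exists_norm_gaussCoeff_le b β hγ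
  refine ⟨∑' j : ℕ, ((j : ℝ) + 1) ^ N * r ^ j, fun n z hz => ?_⟩
  have hr0 : 0 ≤ r := (norm_nonneg z).trans hz.le
  refine tsum_of_norm_bounded (summable_succ_pow_mul_geometric hr0 hr N).hasSum fun j => ?_
  rw [norm_mul, norm_pow]
  exact mul_le_mul (hN n j) (pow_le_pow_left₀ (norm_nonneg z) hz.le j) (by positivity)
    (by positivity)

theorem hasDerivAt_GaussF (b β : ℂ) {γ : ℂ} (hγ : notNonposInt γ) {z : ℂ} (hz : ‖z‖ < 1) :
    HasDerivAt (GaussF b β γ)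
      ((b * GaussF b β γ z - b * (γ - β) / γ * GaussF (b + 1) β (γ + 1) z) / (1 - z)) z := by
  obtain ⟨r, hzr, hr⟩ := exists_between hz
  have hr0 : 0 ≤ r := (norm_nonneg z).trans hzr.le
  obtain ⟨N, hN⟩ := exists_norm_gaussCoeff_le b β hγ
  have hzU : z ∈ Metric.ball (0 : ℂ) r := by simpa using hzr
  set f : ℕ → ℂ := fun j => poch b j * poch β j / ((j.factorial : ℂ) * poch γ j) with hf
  have hfN : ∀ j, ‖f j‖ ≤ ((j : ℝ) + 1) ^ N := fun j => by
    simpa only [Nat.cast_zero, add_zero] using hN 0 j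
  have hu := summable_succ_pow_mul_geometric hr0 hr N
  have hdiff : ∀ j : ℕ, DifferentiableOn ℂ (fun w : ℂ => f j * w ^ j) (Metric.ball 0 r) :=
    fun j => by fun_prop
  have hle : ∀ (j : ℕ) (w : ℂ), w ∈ Metric.ball (0 : ℂ) r →
      ‖f j * w ^ j‖ ≤ ((j : ℝ) + 1) ^ N * r ^ j := fun j w hw => by
    have hw' : ‖w‖ < r := by simpa using hw
    rw [norm_mul, norm_pow]
    exact mul_le_mul (hfN j) (pow_le_pow_left₀ (norm_nonneg w) hw'.le j) (by positivity)
      (by positivity)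
  have hD : DifferentiableAt ℂ (GaussF b β γ) z :=
    (differentiableOn_tsum_of_summable_norm hu hdiff Metric.isOpen_ball hle).differentiableAt
      (Metric.isOpen_ball.mem_nhds hzU)
  have hs1 : HasSum (fun j : ℕ => (j : ℂ) * f j * z ^ (j - 1)) (deriv (GaussF b β γ) z) := by
    refine (hasSum_deriv_of_summable_norm hu hdiff Metric.isOpen_ball hle hzU).congr_fun
      fun j => ?_
    rw [deriv_const_mul_field, deriv_pow_field]
    ring
  have hs2 : HasSum (fun j : ℕ => ((j : ℂ) + 1) * f (j + 1) * z ^ j)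
      (deriv (GaussF b β γ) z) := by
    have := (hasSum_nat_add_iff' 1).mpr hs1
    simpa using this
  have hs3 : HasSum (fun j : ℕ => (j : ℂ) * f j * z ^ j) (z * deriv (GaussF b β γ) z) := by
    refine (hs1.mul_left z).congr_fun fun j => ?_
    cases j with
    | zero => simp
    | succ j =>
      rw [Nat.add_sub_cancel, pow_succ]
      ring
  have hs4 : HasSum (fun j : ℕ => f j * z ^ j) (GaussF b β γ z) :=
    (Summable.of_norm_bounded hu fun j => hle j z hzU).hasSum
  have hs5 := (hs2.sub hs3).sub (hs4.mul_left b)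
  have hs6 : b * (γ - β) / γ * GaussF (b + 1) β (γ + 1) z =
      -(deriv (GaussF b β γ) z - z * deriv (GaussF b β γ) z - b * GaussF b β γ z) := by
    rw [← hs5.tsum_eq, GaussF, ← tsum_mul_left, ← tsum_neg]
    refine tsum_congr fun j => ?_
    have hγ0 := hγ.ne_zero
    have hγj := hγ.add_natCast_ne_zero j
    have hpj := hγ.poch_ne_zero j
    have hb : b * poch (b + 1) j = poch b j * (b + j) := by rw [← poch_succ_left, poch_succ]
    have hγs : γ * poch (γ + 1) j = poch γ j * (γ + j) := by rw [← poch_succ_left, poch_succ]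
    have hjf : (j.factorial : ℂ) ≠ 0 := Nat.cast_ne_zero.mpr j.factorial_ne_zero
    have hj1 : (j : ℂ) + 1 ≠ 0 := Nat.cast_add_one_ne_zero j
    have hL : b * (γ - β) / γ * (poch (b + 1) j * poch β j /
        ((j.factorial : ℂ) * poch (γ + 1) j) * z ^ j) =
        (γ - β) * (b * poch (b + 1) j) * poch β j /
        ((j.factorial : ℂ) * (γ * poch (γ + 1) j)) * z ^ j := by
      rw [div_mul_eq_mul_div, ← mul_assoc, mul_div_assoc', div_mul_eq_mul_div,
        div_div, div_mul_eq_mul_div]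
      congr 1 <;> ring
    rw [hL, hb, hγs]
    simp only [hf, poch_succ, Nat.factorial_succ]
    push_cast
    field_simp
    ring
  have h1z : 1 - z ≠ 0 := fun h => by
    rw [← sub_eq_zero.mp h] at hz
    simp at hz
  refine hD.hasDerivAt.congr_deriv ?_
  rw [hs6, eq_div_iff h1z]
  ring

theorem factorial_mul_inv_poch_le {e : ℂ} (he : notNonposInt e) :
    ∃ N : ℕ, ∀ n : ℕ, ‖(poch e n)⁻¹‖ * (n.factorial : ℝ) ≤ ((n : ℝ) + 1) ^ N := by
  obtain ⟨N, hN⟩ := exists_norm_poch_div_le 1 he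
  refine ⟨N, fun n => ?_⟩
  have := hN 0 n
  simp only [Nat.cast_zero, add_zero, poch_one] at this
  rw [div_eq_inv_mul, norm_mul, Complex.norm_natCast] at this
  exact this

theorem summable_norm_PsiPQ_coeff {p q : ℕ} (hp : p ≤ 1) (hq : q ≤ 1)
    (a c a' b' : ℂ) {e c' d' σ : ℂ} (ρ : ℂ) (hσ : ‖σ‖ < 1)
    (he : notNonposInt e) (hc' : notNonposInt c') (hd' : notNonposInt d') :
    Summable fun mk : ℕ × ℕ => ‖poch a mk.1 * poch c mk.1 * poch a' (p * mk.2) *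
      poch b' (q * (mk.1 + mk.2)) / ((mk.1.factorial : ℂ) * (mk.2.factorial : ℂ) *
      poch e (mk.1 + mk.2) * poch c' (p * mk.2) * poch d' (q * (mk.1 + mk.2))) *
      σ ^ mk.1 * ρ ^ mk.2‖ := by
  obtain ⟨N₁, h₁⟩ := exists_norm_poch_div_le a notNonposInt_one
  obtain ⟨N₂, h₂⟩ := exists_norm_poch_le_factorial c
  obtain ⟨N₃, h₃⟩ := exists_norm_poch_div_le a' hc'
  obtain ⟨N₄, h₄⟩ := exists_norm_poch_div_le b' hd'
  obtain ⟨N₅, h₅⟩ := factorial_mul_inv_poch_le he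
  have hs := (summable_succ_pow_mul_geometric (norm_nonneg σ) hσ
    (N₁ + N₂ + N₄ + N₅)).mul_of_nonneg
    (summable_succ_pow_mul_pow_div_factorial ‖ρ‖ (norm_nonneg ρ) (N₃ + N₄ + N₅))
    (fun n => by positivity) (fun n => by positivity)
  refine hs.of_nonneg_of_le (fun _ => norm_nonneg _) ?_
  rintro ⟨m, k⟩
  dsimp only
  have hmk : ((m + k : ℕ) : ℝ) + 1 ≤ ((m : ℝ) + 1) * (k + 1) := by
    push_cast
    nlinarith [mul_nonneg (Nat.cast_nonneg m : (0 : ℝ) ≤ m) (Nat.cast_nonneg k : (0 : ℝ) ≤ k)]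
  have e1 := h₁ 0 m
  simp only [Nat.cast_zero, add_zero, poch_one] at e1
  have e2 : ‖poch c m‖ * ‖(poch e (m + k))⁻¹‖ ≤
      ((m : ℝ) + 1) ^ N₂ * (((m : ℝ) + 1) * (k + 1)) ^ N₅ := by
    calc ‖poch c m‖ * ‖(poch e (m + k))⁻¹‖
        ≤ (((m : ℝ) + 1) ^ N₂ * m.factorial) * ‖(poch e (m + k))⁻¹‖ := by
          gcongr
          exact h₂ m
      _ ≤ (((m : ℝ) + 1) ^ N₂ * (m + k).factorial) * ‖(poch e (m + k))⁻¹‖ := by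
          gcongr
          exact Nat.le_add_right m k
      _ = ((m : ℝ) + 1) ^ N₂ * (‖(poch e (m + k))⁻¹‖ * (m + k).factorial) := by ring
      _ ≤ ((m : ℝ) + 1) ^ N₂ * (((m + k : ℕ) : ℝ) + 1) ^ N₅ := by
          gcongr
          exact h₅ (m + k)
      _ ≤ _ := by gcongr
  have e3 : ‖poch a' (p * k) / poch c' (p * k)‖ ≤ ((k : ℝ) + 1) ^ N₃ := by
    have := h₃ 0 (p * k)
    simp only [Nat.cast_zero, add_zero] at this
    refine this.trans ?_
    gcongr
    exact (Nat.mul_le_mul_right k hp).trans_eq (one_mul k)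
  have e4 : ‖poch b' (q * (m + k)) / poch d' (q * (m + k))‖ ≤
      (((m : ℝ) + 1) * (k + 1)) ^ N₄ := by
    have := h₄ 0 (q * (m + k))
    simp only [Nat.cast_zero, add_zero] at this
    refine this.trans ?_
    gcongr
    refine le_trans ?_ hmk
    gcongr
    exact (Nat.mul_le_mul_right (m + k) hq).trans_eq (one_mul (m + k))
  have hsplit : poch a m * poch c m * poch a' (p * k) * poch b' (q * (m + k)) /
      ((m.factorial : ℂ) * (k.factorial : ℂ) * poch e (m + k) * poch c' (p * k) *
      poch d' (q * (m + k))) * σ ^ m * ρ ^ k =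
      (poch a m / (m.factorial : ℂ)) * (poch c m * (poch e (m + k))⁻¹) *
      (poch a' (p * k) / poch c' (p * k)) * (poch b' (q * (m + k)) / poch d' (q * (m + k))) *
      (σ ^ m * (ρ ^ k / (k.factorial : ℂ))) := by
    simp only [div_eq_mul_inv, mul_inv]
    ring
  rw [hsplit, norm_mul, norm_mul, norm_mul, norm_mul, norm_mul (poch c m), norm_mul (σ ^ m),
    norm_div (ρ ^ k), norm_pow, norm_pow, Complex.norm_natCast]
  calc _ ≤ ((m : ℝ) + 1) ^ N₁ * (((m : ℝ) + 1) ^ N₂ * (((m : ℝ) + 1) * (k + 1)) ^ N₅) *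
        ((k : ℝ) + 1) ^ N₃ * (((m : ℝ) + 1) * (k + 1)) ^ N₄ *
        (‖σ‖ ^ m * (‖ρ‖ ^ k / k.factorial)) := by gcongr
    _ = _ := by
      rw [mul_pow, mul_pow]
      ring

theorem hasDerivAt_PsiPQ {p q : ℕ} (hp : p ≤ 1) (hq : q ≤ 1)
    (a b c d a' b' : ℂ) {e c' d' σ z : ℂ} (ρ : ℂ) (hσ : ‖σ‖ < 1) (hz : ‖z‖ < 1)
    (he : notNonposInt e) (hc' : notNonposInt c') (hd' : notNonposInt d') :
    HasDerivAt (fun w => PsiPQ p q a b c d a' b' e c' d' σ w ρ)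
      ((b * PsiPQ p q a b c d a' b' e c' d' σ z ρ -
        b * d / e * PsiPQ p q a (b + 1) c (d + 1) a' b' (e + 1) c' d' σ z ρ) / (1 - z)) z := by
  obtain ⟨r, hzr, hr⟩ := exists_between hz
  have hzU : z ∈ Metric.ball (0 : ℂ) r := by simpa using hzr
  obtain ⟨K, hK⟩ := exists_norm_GaussF_le b (e - d) he hr
  set A : ℕ × ℕ → ℂ := fun mk => poch a mk.1 * poch c mk.1 * poch a' (p * mk.2) *
      poch b' (q * (mk.1 + mk.2)) / ((mk.1.factorial : ℂ) * (mk.2.factorial : ℂ) *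
      poch e (mk.1 + mk.2) * poch c' (p * mk.2) * poch d' (q * (mk.1 + mk.2))) *
      σ ^ mk.1 * ρ ^ mk.2 with hA
  have hu : Summable fun mk => ‖A mk‖ * K :=
    (summable_norm_PsiPQ_coeff hp hq a c a' b' ρ hσ he hc' hd').mul_right K
  set G : ℕ × ℕ → ℂ → ℂ := fun mk =>
    GaussF b (e - d + (mk.1 + mk.2 : ℕ)) (e + (mk.1 + mk.2 : ℕ)) with hG
  have hPsi : (fun w => PsiPQ p q a b c d a' b' e c' d' σ w ρ) =
      fun w => ∑' mk, A mk * G mk w := by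
    funext w
    refine tsum_congr fun mk => ?_
    simp only [hA, hG]
    push_cast
    rw [← add_assoc, ← add_assoc]
    ring
  have hder : ∀ (mk : ℕ × ℕ) (w : ℂ), ‖w‖ < 1 → HasDerivAt (G mk) _ w := fun mk w hw =>
    hasDerivAt_GaussF b (e - d + (mk.1 + mk.2 : ℕ)) (he.add_natCast (mk.1 + mk.2)) hw
  have hdiff : ∀ mk, DifferentiableOn ℂ (fun w => A mk * G mk w) (Metric.ball 0 r) :=
    fun mk w hw => by
      have hw' : ‖w‖ < r := by simpa using hw
      exact ((hder mk w (hw'.trans hr)).const_mul (A mk)).differentiableAt.differentiableWithinAt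
  have hle : ∀ (mk : ℕ × ℕ) (w : ℂ), w ∈ Metric.ball (0 : ℂ) r →
      ‖A mk * G mk w‖ ≤ ‖A mk‖ * K := fun mk w hw => by
    rw [norm_mul]
    gcongr
    exact hK _ w (by simpa using hw)
  have hD : DifferentiableAt ℂ (fun w => ∑' mk, A mk * G mk w) z :=
    (differentiableOn_tsum_of_summable_norm hu hdiff Metric.isOpen_ball hle).differentiableAt
      (Metric.isOpen_ball.mem_nhds hzU)
  have hs1 := hasSum_deriv_of_summable_norm hu hdiff Metric.isOpen_ball hle hzU
  have hs2 : HasSum (fun mk => A mk * G mk z) (∑' mk, A mk * G mk z) :=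
    (Summable.of_norm_bounded hu fun mk => hle mk z hzU).hasSum
  have h1z : 1 - z ≠ 0 := fun h => by
    rw [← sub_eq_zero.mp h] at hz
    simp at hz
  have key : b * d / e * PsiPQ p q a (b + 1) c (d + 1) a' b' (e + 1) c' d' σ z ρ =
      b * (∑' mk, A mk * G mk z) - (1 - z) * deriv (fun w => ∑' mk, A mk * G mk w) z := by
    rw [← ((hs2.mul_left b).sub (hs1.mul_left (1 - z))).tsum_eq, PsiPQ, ← tsum_mul_left]
    refine tsum_congr fun mk => ?_
    rw [((hder mk z hz).const_mul (A mk)).deriv]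
    have hes : e * poch (e + 1) (mk.1 + mk.2) =
        poch e (mk.1 + mk.2) * (e + (mk.1 + mk.2 : ℕ)) := by
      rw [← poch_succ_left, poch_succ]
    rw [show e + 1 - (d + 1) + (mk.1 : ℂ) + (mk.2 : ℂ) = e - d + (mk.1 + mk.2 : ℕ) by
        push_cast; ring,
      show e + 1 + (mk.1 : ℂ) + (mk.2 : ℂ) = e + (mk.1 + mk.2 : ℕ) + 1 by push_cast; ring]
    generalize GaussF (b + 1) (e - d + (mk.1 + mk.2 : ℕ)) (e + (mk.1 + mk.2 : ℕ) + 1) z = H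
    rw [show e + ((mk.1 + mk.2 : ℕ) : ℂ) - (e - d + ((mk.1 + mk.2 : ℕ) : ℂ)) = d by ring]
    have hR : ∀ x y : ℂ, b * (A mk * x) - (1 - z) * (A mk * ((b * x - y) / (1 - z))) =
        A mk * y := fun x y => by
      field_simp
      ring
    rw [hR]
    have hinv : e⁻¹ * (poch (e + 1) (mk.1 + mk.2))⁻¹ =
        (poch e (mk.1 + mk.2))⁻¹ * (e + (mk.1 + mk.2 : ℕ))⁻¹ := by
      rw [← mul_inv, hes, mul_inv]
    simp only [hA, div_eq_mul_inv, mul_inv]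
    linear_combination (b * d * H * σ ^ mk.1 * ρ ^ mk.2 * poch a mk.1 * poch c mk.1 *
      poch a' (p * mk.2) * poch b' (q * (mk.1 + mk.2)) * (mk.1.factorial : ℂ)⁻¹ *
      (mk.2.factorial : ℂ)⁻¹ * (poch c' (p * mk.2))⁻¹ *
      (poch d' (q * (mk.1 + mk.2)))⁻¹) * hinv
  have hPz : PsiPQ p q a b c d a' b' e c' d' σ z ρ = ∑' mk, A mk * G mk z := congrFun hPsi z
  rw [key, hPz, hPsi]
  refine hD.hasDerivAt.congr_deriv ?_
  rw [eq_div_iff h1z]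
  ring

/-- Differentiation formula (19):
`∂/∂θ [(1−θ)^b Ψ_{pq}] = −(bd/e)(1−θ)^{b−1} Ψ_{pq}[a,b+1,c,d+1;a',b'|e+1;c',d';σ,θ,ρ]`. -/
theorem Psi_deriv_theta (p q : ℕ) (hp : p ≤ 1) (hq : q ≤ 1)
    (a b c d a' b' e c' d' σ ρ : ℂ) (θ : ℝ)
    (hσ : ‖σ‖ < 1) (hθ : |θ| < 1)
    (he : notNonposInt e) (hc' : notNonposInt c') (hd' : notNonposInt d') :
    HasDerivAt
      (fun t : ℝ => ((1 : ℂ) - (t : ℂ)) ^ b * PsiPQ p q a b c d a' b' e c' d' σ (t : ℂ) ρ)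
      (-(b * d / e) * ((1 : ℂ) - (θ : ℂ)) ^ (b - 1) *
        PsiPQ p q a (b + 1) c (d + 1) a' b' (e + 1) c' d' σ (θ : ℂ) ρ) θ := by
  have hz : ‖(θ : ℂ)‖ < 1 := by simpa using hθ
  have hre : 0 < (1 - (θ : ℂ)).re := by
    have := (abs_lt.mp hθ).2
    simpa using this
  have hslit : 1 - (θ : ℂ) ∈ slitPlane := Or.inl hre
  have h1z : 1 - (θ : ℂ) ≠ 0 := slitPlane_ne_zero hslit
  have hpow : HasDerivAt (fun w : ℂ => (1 - w) ^ b) (b * (1 - (θ : ℂ)) ^ (b - 1) * -1) (θ : ℂ) :=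
    ((hasDerivAt_id (θ : ℂ)).const_sub 1).cpow_const hslit
  have h := (hpow.mul (hasDerivAt_PsiPQ hp hq a b c d a' b' ρ hσ hz he hc' hd')).comp_ofReal
  refine h.congr_deriv ?_
  have hb : (1 - (θ : ℂ)) ^ b = (1 - (θ : ℂ)) ^ (b - 1) * (1 - (θ : ℂ)) := by
    rw [cpow_sub _ _ h1z, cpow_one, div_mul_cancel₀ _ h1z]
  rw [hb, mul_assoc _ (1 - (θ : ℂ)), mul_div_cancel₀ _ h1z]
  ring
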